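/- arXiv:2411.11298 — 3 statements merged into one kernel-verified Lean document; each statement's English description precedes it below -/
import Mathlib

section
/- There exist a constant c > 0 and infinitely many lengths n such that for each such n there is a string w of length n with r(w) ≥ c · r_B(w) · log₂ n. Concretely, for every integer k ≥ 3, the string w_k = b · F*_{2k} over the alphabet {a, b} with a < b, which has length f_{2k} + 1, satisfies r_B(w_k) = 3 and r(w_k) = 2k. -/
/-! Basic definitions: strings as `List α`, rotations, runs, BWT, Lyndon
factorization, ω-order, bijective BWT, and Fibonacci words. -/

variable {α : Type*}

/-- Left cyclic rotation by one symbol. -/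
def rot (x : List α) : List α := x.drop 1 ++ x.take 1

/-- The list of all `|x|` cyclic rotations of `x`. -/
def rotations (x : List α) : List (List α) :=
  (List.range x.length).map (fun i => rot^[i] x)

/-- ρ: the number of maximal runs of equal consecutive symbols. -/
def runsCount [DecidableEq α] : List α → ℕ
  | [] => 0
  | [_] => 1
  | a :: b :: t => (if a = b then 0 else 1) + runsCount (b :: t)

/-- The Burrows–Wheeler transform: last symbols of the lexicographically
sorted rotations. -/
def BWT [LinearOrder α] (w : List α) : List α :=
  (List.insertionSort (· ≤ ·) (rotations w)).filterMap List.getLast?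

/-- The lexicographically smallest rotation of `x`. -/
def lexMinRotation [LinearOrder α] (x : List α) : List α :=
  (List.insertionSort (· ≤ ·) (rotations x)).headD x

/-- A Lyndon word: nonempty and strictly smaller than all its proper rotations. -/
def IsLyndon [LinearOrder α] (x : List α) : Prop :=
  x ≠ [] ∧ ∀ i < x.length, 0 < i → x < rot^[i] x

instance [LinearOrder α] : DecidablePred (IsLyndon (α := α)) := fun _ =>
  inferInstanceAs (Decidable (_ ∧ _))

/-- The longest prefix of `w` that is a Lyndon word (the first Lyndon factor). -/
def firstLyndonFactor [LinearOrder α] (w : List α) : List α :=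
  (((List.range (w.length + 1)).map (fun i => w.take i)).filter
    (fun x => decide (IsLyndon x))).getLastD []

def lyndonFactAux [LinearOrder α] : ℕ → List α → List (List α)
  | 0, _ => []
  | _, [] => []
  | fuel+1, w =>
      let p := firstLyndonFactor w
      if p.isEmpty then [] else p :: lyndonFactAux fuel (w.drop p.length)

/-- The Lyndon factorization of `w`: repeatedly peel off the longest Lyndon
prefix (equivalently, the unique nonincreasing factorization into Lyndon words). -/
def lyndonFactorization [LinearOrder α] (w : List α) : List (List α) :=
  lyndonFactAux w.length w

/-- `listPow x n = x^n`. -/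
def listPow (x : List α) : ℕ → List α
  | 0 => []
  | n+1 => x ++ listPow x n

/-- ω-order: `x ≤ω y` iff `x^∞ ≤ y^∞` lexicographically; comparing the
equal-length words `x^{|y|}` and `y^{|x|}` is equivalent. -/
def omegaLE [LinearOrder α] (x y : List α) : Prop :=
  listPow x y.length ≤ listPow y x.length

instance [LinearOrder α] : DecidableRel (omegaLE (α := α)) := fun _ _ =>
  inferInstanceAs (Decidable (_ ≤ _))

/-- The bijective Burrows–Wheeler transform: last symbols of all rotations of
all Lyndon factors of `w`, sorted in ω-order. -/
def BBWT [LinearOrder α] (w : List α) : List α :=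
  (List.insertionSort omegaLE
    (((lyndonFactorization w).map rotations).flatten)).filterMap List.getLast?

/-- Fibonacci words over symbols `a < b`: `F 0 = b`, `F 1 = a`,
`F (i+2) = F (i+1) ++ F i`. -/
def fibWordG (a b : α) : ℕ → List α
  | 0 => [b]
  | 1 => [a]
  | n+2 => fibWordG a b (n+1) ++ fibWordG a b n

/-- Fibonacci words over `Fin 2` with `a = 0 < b = 1`. -/
def fibWord : ℕ → List (Fin 2) := fibWordG 0 1

/-! ### Rotations -/

theorem rot_cons (c : α) (x : List α) : rot (c :: x) = x ++ [c] := by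
  simp [rot]

theorem rot_eq_rotate (x : List α) : rot x = x.rotate 1 := by
  cases x <;> simp [rot]

theorem rot_iterate (i : ℕ) (x : List α) : rot^[i] x = x.rotate i := by
  induction i generalizing x with
  | zero => simp
  | succ i ih => rw [Function.iterate_succ_apply, ih, rot_eq_rotate, List.rotate_rotate, add_comm]

theorem isRotated_of_mem_rotations {x y : List α} (h : y ∈ rotations x) : x ~r y := by
  simp only [rotations, List.mem_map, rot_iterate] at h
  obtain ⟨i, -, rfl⟩ := h
  exact ⟨i, rfl⟩

theorem map_rot_rotations_perm (x : List α) : ((rotations x).map rot).Perm (rotations x) := by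
  have h : x :: (rotations x).map rot = rotations x ++ [x] := by
    have h1 : (List.range (x.length + 1)).map (fun i => rot^[i] x) =
        x :: (rotations x).map rot := by
      rw [List.range_succ_eq_map]
      simp only [List.map_cons, List.map_map, rotations, Function.iterate_zero, id,
        List.cons.injEq, true_and]
      exact List.map_congr_left fun i _ => Function.iterate_succ_apply' rot i x
    rw [← h1, List.range_succ]
    simp [rotations, rot_iterate]
  have h2 : (rotations x ++ [x]).Perm (x :: rotations x) := List.perm_append_singleton _ _
  rw [← h] at h2
  exact h2.cons_inv

theorem rotations_rot_perm (x : List α) : (rotations (rot x)).Perm (rotations x) := by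
  have h : rotations (rot x) = (rotations x).map rot := by
    have hl : (rot x).length = x.length := by simp [rot_eq_rotate]
    rw [rotations, rotations, hl, List.map_map]
    refine List.map_congr_left fun i _ => ?_
    rw [Function.comp_apply, ← Function.iterate_succ_apply, Function.iterate_succ_apply']
  rw [h]
  exact map_rot_rotations_perm x

theorem rotations_perm_of_isRotated {x y : List α} (h : x ~r y) :
    (rotations x).Perm (rotations y) := by
  obtain ⟨n, rfl⟩ := h
  rw [← rot_iterate]
  induction n with
  | zero => simp
  | succ n ih =>
    rw [Function.iterate_succ_apply']
    exact ih.trans (rotations_rot_perm _).symm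

/-- The rotations of `p ++ s` starting at a position of `s`. -/
def rotationsFrom (p : List α) : List α → List (List α)
  | [] => []
  | c :: s => (c :: s ++ p) :: rotationsFrom (p ++ [c]) s

theorem rotationsFrom_eq (p s : List α) :
    rotationsFrom p s = (List.range s.length).map (fun i => rot^[i] (s ++ p)) := by
  induction s generalizing p with
  | nil => simp [rotationsFrom]
  | cons c s ih =>
    rw [rotationsFrom, ih, List.length_cons, List.range_succ_eq_map]
    simp [Function.comp_def, rot_cons]

theorem rotations_eq_rotationsFrom (x : List α) : rotations x = rotationsFrom [] x := by
  simp [rotationsFrom_eq, rotations]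

/-- Right cyclic rotation by one symbol. -/
def rotRight (x : List α) : List α := x.getLast?.toList ++ x.dropLast

@[simp] theorem rotRight_concat (x : List α) (c : α) : rotRight (x ++ [c]) = c :: x := by
  simp [rotRight]

/-! ### The morphism `0 ↦ aab`, `1 ↦ ab`, `2 ↦ c` -/

/-- Images of the letters under the morphism `0 ↦ aab`, `1 ↦ ab`, `2 ↦ c`. -/
def letterImage (a b c : α) : Fin 3 → List α
  | 0 => [a, a, b]
  | 1 => [a, b]
  | 2 => [c]

/-- The morphism `0 ↦ aab`, `1 ↦ ab`, `2 ↦ c`. -/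
def morphism (a b c : α) (x : List (Fin 3)) : List α := x.flatMap (letterImage a b c)

section morphism

variable (a b c : α)

@[simp] theorem morphism_nil : morphism a b c [] = [] := rfl

@[simp] theorem morphism_zero (x : List (Fin 3)) :
    morphism a b c (0 :: x) = a :: a :: b :: morphism a b c x := rfl

@[simp] theorem morphism_one (x : List (Fin 3)) :
    morphism a b c (1 :: x) = a :: b :: morphism a b c x := rfl

@[simp] theorem morphism_two (x : List (Fin 3)) :
    morphism a b c (2 :: x) = c :: morphism a b c x := rfl

@[simp] theorem morphism_append (x y : List (Fin 3)) :
    morphism a b c (x ++ y) = morphism a b c x ++ morphism a b c y :=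
  List.flatMap_append

theorem morphism_isRotated {x y : List (Fin 3)} (h : x ~r y) :
    morphism a b c x ~r morphism a b c y := by
  obtain ⟨n, rfl⟩ := h
  rw [List.rotate_eq_drop_append_take_mod]
  conv_lhs => rw [← List.take_append_drop (n % x.length) x]
  rw [morphism_append, morphism_append]
  exact List.isRotated_append

/-- The rotations of `morphism a b c (p ++ s)` starting in the image of `s`, grouped by the letter
they start with and by the one following it. -/
theorem rotationsFrom_morphism_perm (p s : List (Fin 3)) :
    (rotationsFrom (morphism a b c p) (morphism a b c s)).Perm
      (((rotationsFrom p s).filter (fun x => x.head? = some 0)).map (morphism a b c) ++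
        (((rotationsFrom p s).filter (fun x => x.head? ≠ some 2)).map
            (fun x => rotRight (rotRight (morphism a b c (rot x)))) ++
          (rotationsFrom p s).map (fun x => rotRight (morphism a b c (rot x))))) := by
  induction s generalizing p with
  | nil => simp [rotationsFrom]
  | cons d s ih =>
    have hd := ih (p ++ [d])
    match d with
    | 0 =>
      have e2 : rotRight (rotRight (morphism a b c (s ++ p ++ [0]))) =
          a :: b :: (morphism a b c s ++ morphism a b c p ++ [a]) := by
        rw [show morphism a b c (s ++ p ++ [0]) =
          (morphism a b c s ++ morphism a b c p ++ [a]) ++ [a] ++ [b] by simp, rotRight_concat,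
          ← List.cons_append, rotRight_concat]
      have e3 : rotRight (morphism a b c (s ++ p ++ [0])) =
          b :: (morphism a b c s ++ morphism a b c p ++ [a, a]) := by
        rw [show morphism a b c (s ++ p ++ [0]) =
          (morphism a b c s ++ morphism a b c p ++ [a, a]) ++ [b] by simp, rotRight_concat]
      have l : rotationsFrom (morphism a b c p) (morphism a b c (0 :: s)) =
          morphism a b c (0 :: s ++ p) ::
          (a :: b :: (morphism a b c s ++ morphism a b c p ++ [a])) ::
          (b :: (morphism a b c s ++ morphism a b c p ++ [a, a])) ::
          rotationsFrom (morphism a b c (p ++ [0])) (morphism a b c s) := by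
        simp [rotationsFrom]
      rw [l]
      simp only [rotationsFrom, List.filter_cons, List.cons_append, List.head?_cons, List.map_cons,
        rot_cons, e3, decide_true, if_true]
      simp only [ne_eq, Option.some.injEq, Fin.reduceEq, not_false_eq_true, decide_true, if_true,
        List.map_cons, rot_cons, e2, List.cons_append]
      refine List.Perm.cons _ (List.Perm.trans (List.Perm.cons _ ?_) List.perm_middle.symm)
      rw [← List.append_assoc]
      refine List.Perm.trans (List.Perm.cons _ ?_) List.perm_middle.symm
      rw [List.append_assoc]
      exact hd
    | 1 =>
      have e2 : rotRight (rotRight (morphism a b c (s ++ p ++ [1]))) =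
          a :: b :: (morphism a b c s ++ morphism a b c p) := by
        rw [show morphism a b c (s ++ p ++ [1]) =
          (morphism a b c s ++ morphism a b c p) ++ [a] ++ [b] by simp, rotRight_concat,
          ← List.cons_append, rotRight_concat]
      have e3 : rotRight (morphism a b c (s ++ p ++ [1])) =
          b :: (morphism a b c s ++ morphism a b c p ++ [a]) := by
        rw [show morphism a b c (s ++ p ++ [1]) =
          (morphism a b c s ++ morphism a b c p ++ [a]) ++ [b] by simp, rotRight_concat]
      have l : rotationsFrom (morphism a b c p) (morphism a b c (1 :: s)) =
          (a :: b :: (morphism a b c s ++ morphism a b c p)) ::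
          (b :: (morphism a b c s ++ morphism a b c p ++ [a])) ::
          rotationsFrom (morphism a b c (p ++ [1])) (morphism a b c s) := by
        simp [rotationsFrom]
      rw [l]
      simp only [rotationsFrom, List.filter_cons, List.cons_append, List.head?_cons, List.map_cons,
        rot_cons, e3, Option.some.injEq, Fin.reduceEq, decide_false, Bool.false_eq_true, if_false]
      simp only [ne_eq, Option.some.injEq, Fin.reduceEq, not_false_eq_true, decide_true, if_true,
        List.map_cons, rot_cons, e2, List.cons_append]
      refine List.Perm.trans (List.Perm.cons _ ?_) List.perm_middle.symm
      rw [← List.append_assoc]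
      refine List.Perm.trans (List.Perm.cons _ ?_) List.perm_middle.symm
      rw [List.append_assoc]
      exact hd
    | 2 =>
      have e3 : rotRight (morphism a b c (s ++ p ++ [2])) =
          c :: (morphism a b c s ++ morphism a b c p) := by
        rw [show morphism a b c (s ++ p ++ [2]) =
          (morphism a b c s ++ morphism a b c p) ++ [c] by simp, rotRight_concat]
      have l : rotationsFrom (morphism a b c p) (morphism a b c (2 :: s)) =
          (c :: (morphism a b c s ++ morphism a b c p)) ::
          rotationsFrom (morphism a b c (p ++ [2])) (morphism a b c s) := by
        simp [rotationsFrom]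
      rw [l]
      simp only [rotationsFrom, List.filter_cons, List.cons_append, List.head?_cons, List.map_cons,
        rot_cons, e3, ne_eq, Option.some.injEq, Fin.reduceEq, not_true_eq_false, decide_false,
        Bool.false_eq_true, if_false]
      rw [← List.append_assoc]
      refine List.Perm.trans (List.Perm.cons _ ?_) List.perm_middle.symm
      rw [List.append_assoc]
      exact hd

/-- The rotations of `morphism a b c u`, grouped as those starting with `aa`, those starting with
`ab`, and the remaining ones; each group is expressed through the rotations of `u`. -/
theorem rotations_morphism_perm {u : List (Fin 3)} {S : List (List (Fin 3))}
    (hS : S.Perm (rotations u)) :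
    (rotations (morphism a b c u)).Perm
      ((S.filter (fun x => x.head? = some 0)).map (morphism a b c) ++
        ((S.filter (fun x => x.getLast? ≠ some 2)).map
            (fun x => rotRight (rotRight (morphism a b c x))) ++
          S.map (fun x => rotRight (morphism a b c x)))) := by
  have h := rotationsFrom_morphism_perm a b c [] u
  rw [← rotations_eq_rotationsFrom, morphism_nil, ← rotations_eq_rotationsFrom] at h
  have hrot : ((rotations u).map rot).Perm S := (map_rot_rotations_perm u).trans hS.symm
  refine h.trans (((hS.symm.filter _).map _).append (List.Perm.append ?_ ?_))
  · have e : ((rotations u).map rot).filter (fun x => x.getLast? ≠ some 2) =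
        ((rotations u).filter (fun x => x.head? ≠ some 2)).map rot := by
      rw [List.filter_map]
      congr 1
      refine List.filter_congr fun x hx => ?_
      cases x <;> simp [rot]
    have h2 := ((hrot.filter (fun x => x.getLast? ≠ some 2)).map
      (fun x => rotRight (rotRight (morphism a b c x))))
    rw [e, List.map_map] at h2
    exact h2
  · have h3 := hrot.map (fun x => rotRight (morphism a b c x))
    rw [List.map_map] at h3
    exact h3

end morphism

/-! ### Monotonicity -/

section order

variable [LinearOrder α]

theorem append_lt_append_of_length_eq {x y : List α} (hl : x.length = y.length) (h : x < y)
    (z w : List α) : x ++ z < y ++ w := by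
  induction x generalizing y with
  | nil =>
    cases y with
    | nil => exact absurd h (lt_irrefl _)
    | cons d y => simp at hl
  | cons c x ih =>
    cases y with
    | nil => simp at hl
    | cons d y =>
      rw [List.cons_append, List.cons_append, List.cons_lt_cons_iff]
      rcases List.cons_lt_cons_iff.1 h with h | ⟨h, h'⟩
      · exact Or.inl h
      · exact Or.inr ⟨h, ih (by simpa using hl) h'⟩

theorem lt_of_append_lt_append_right {x y z : List α} (hl : x.length = y.length)
    (h : x ++ z < y ++ z) : x < y := by
  rcases lt_trichotomy x y with h1 | h1 | h1
  · exact h1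
  · exact absurd h (by simp [h1])
  · exact absurd h (lt_asymm (append_lt_append_of_length_eq hl.symm h1 z z))

theorem morphism_lt_morphism {a b c : α} (hab : a < b) (hbc : b ≤ c) {x y : List (Fin 3)}
    (h : x < y) : morphism a b c x < morphism a b c y := by
  have hac := hab.trans_le hbc
  induction x generalizing y with
  | nil =>
    cases y with
    | nil => exact absurd h (lt_irrefl _)
    | cons d y => fin_cases d <;> simp [morphism, letterImage]
  | cons d x ih =>
    cases y with
    | nil => simp at h
    | cons e y =>
      rcases List.cons_lt_cons_iff.1 h with h | ⟨rfl, h'⟩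
      · fin_cases d <;> fin_cases e <;>
          simp [List.cons_lt_cons_iff, hab, hac] at h ⊢
      · have := ih h'
        fin_cases d <;> simpa [List.cons_lt_cons_iff] using this

theorem rotRight_concat_lt {x y : List α} {e : α} (hl : x.length = y.length)
    (h : x ++ [e] < y ++ [e]) : rotRight (x ++ [e]) < rotRight (y ++ [e]) := by
  rw [rotRight_concat, rotRight_concat, List.cons_lt_cons_iff]
  exact Or.inr ⟨rfl, lt_of_append_lt_append_right hl h⟩

theorem insertionSort_eq_of_perm {l S : List (List α)} (hp : l.Perm S) (hS : S.Pairwise (· < ·)) :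
    List.insertionSort (· ≤ ·) l = S :=
  List.Perm.eq_of_pairwise (fun _ _ _ _ h1 h2 => le_antisymm h1 h2)
    (List.pairwise_insertionSort _ _) (hS.imp le_of_lt) ((List.perm_insertionSort _ _).trans hp)

end order

/-- `S` is the lexicographically sorted list of the rotations of the primitive word `u`. -/
def IsSortedRotations [LinearOrder α] (u : List α) (S : List (List α)) : Prop :=
  S.Perm (rotations u) ∧ S.Pairwise (· < ·)

theorem exists_morphism_eq_concat (a b c : α) {x : List (Fin 3)} (hx : x ≠ []) :
    ∃ z, (x.getLast? ≠ some 2 ∧ morphism a b c x = z ++ [a, b]) ∨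
      (x.getLast? = some 2 ∧ morphism a b c x = z ++ [c]) := by
  obtain ⟨y, d, rfl⟩ : ∃ y d, x = y ++ [d] := ⟨_, _, (List.dropLast_append_getLast hx).symm⟩
  match d with
  | 0 => exact ⟨morphism a b c y ++ [a], by simp⟩
  | 1 => exact ⟨morphism a b c y, by simp⟩
  | 2 => exact ⟨morphism a b c y, by simp⟩

theorem rotRight_rotRight_concat (z : List α) (a b : α) :
    rotRight (rotRight (z ++ [a, b])) = a :: b :: z := by
  rw [show z ++ [a, b] = z ++ [a] ++ [b] by simp, rotRight_concat, ← List.cons_append,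
    rotRight_concat]

section sorted

variable {u : List (Fin 3)} {S : List (List (Fin 3))}

theorem IsSortedRotations.isRotated [LinearOrder α] {u : List α} {S : List (List α)}
    (hS : IsSortedRotations u S)
    {x : List α} (hx : x ∈ S) : u ~r x :=
  isRotated_of_mem_rotations (hS.1.subset hx)

theorem IsSortedRotations.ne_nil [LinearOrder α] {u : List α} {S : List (List α)}
    (hS : IsSortedRotations u S)
    {x : List α} (hx : x ∈ S) : x ≠ [] := by
  rintro rfl
  have h := hS.isRotated hx
  rw [List.isRotated_nil_iff] at h
  subst h
  simpa [rotations] using hS.1.subset hx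

theorem IsSortedRotations.length_morphism_eq (hS : IsSortedRotations u S) (a b c : α)
    {x y : List (Fin 3)} (hx : x ∈ S) (hy : y ∈ S) :
    (morphism a b c x).length = (morphism a b c y).length :=
  ((morphism_isRotated a b c (hS.isRotated hx)).symm.trans
    (morphism_isRotated a b c (hS.isRotated hy))).perm.length_eq

theorem exists_rotRight_morphism_eq_cons (hS : IsSortedRotations u S) (a b c : α)
    {x : List (Fin 3)} (hx : x ∈ S) :
    ∃ z, (x.getLast? ≠ some 2 ∧ rotRight (morphism a b c x) = b :: z) ∨
      (x.getLast? = some 2 ∧ rotRight (morphism a b c x) = c :: z) := by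
  obtain ⟨z, ⟨h, hz⟩ | ⟨h, hz⟩⟩ := exists_morphism_eq_concat a b c (hS.ne_nil hx)
  · refine ⟨z ++ [a], Or.inl ⟨h, ?_⟩⟩
    rw [hz, show z ++ [a, b] = z ++ [a] ++ [b] by simp, rotRight_concat]
  · exact ⟨z, Or.inr ⟨h, by rw [hz, rotRight_concat]⟩⟩

variable [LinearOrder α] {a b c : α}

theorem rotRight_morphism_lt (hab : a < b) (hbc : b ≤ c) (hS : IsSortedRotations u S)
    {x y : List (Fin 3)} (hx : x ∈ S) (hy : y ∈ S) (h : x < y)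
    (hl : b = c ∨ (x.getLast? = some 2 ↔ y.getLast? = some 2)) :
    rotRight (morphism a b c x) < rotRight (morphism a b c y) := by
  have hlt := morphism_lt_morphism hab hbc h
  have hlen := hS.length_morphism_eq a b c hx hy
  suffices ∃ z w e, morphism a b c x = z ++ [e] ∧ morphism a b c y = w ++ [e] by
    obtain ⟨z, w, e, hz, hw⟩ := this
    rw [hz, hw] at hlt hlen ⊢
    exact rotRight_concat_lt (by simpa using hlen) hlt
  obtain ⟨z, hz⟩ := exists_morphism_eq_concat a b c (hS.ne_nil hx)
  obtain ⟨w, hw⟩ := exists_morphism_eq_concat a b c (hS.ne_nil hy)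
  rcases hl with rfl | hl
  · have aux : ∀ {x z : List _} {p q : Prop}, (p ∧ x = z ++ [a, b]) ∨ (q ∧ x = z ++ [b]) →
        ∃ z, x = z ++ [b] := by
      rintro x z p q (⟨-, rfl⟩ | ⟨-, rfl⟩)
      · exact ⟨z ++ [a], by simp⟩
      · exact ⟨z, rfl⟩
    obtain ⟨z', hz'⟩ := aux hz
    obtain ⟨w', hw'⟩ := aux hw
    exact ⟨z', w', b, hz', hw'⟩
  · rcases hz with ⟨hx2, hz⟩ | ⟨hx2, hz⟩ <;> rcases hw with ⟨hy2, hw⟩ | ⟨hy2, hw⟩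
    · exact ⟨z ++ [a], w ++ [a], b, by simp [hz], by simp [hw]⟩
    · exact absurd (hl.2 hy2) hx2
    · exact absurd (hl.1 hx2) hy2
    · exact ⟨z, w, c, hz, hw⟩

theorem pairwise_morphism_append (hab : a < b) (hbc : b ≤ c) (hS : IsSortedRotations u S)
    {T : List (List α)} (hT : T.Pairwise (· < ·)) (ha : ∀ x ∈ T, ∀ y, a :: y < x) :
    ((S.filter (fun x => x.head? = some 0)).map (morphism a b c) ++
        ((S.filter (fun x => x.getLast? ≠ some 2)).map
            (fun x => rotRight (rotRight (morphism a b c x))) ++ T)).Pairwise (· < ·) := by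
  have h1 : ∀ x ∈ (S.filter (fun x => x.head? = some 0)).map (morphism a b c),
      ∃ y, x = a :: a :: y := by
    intro x hx
    rw [List.mem_map] at hx
    obtain ⟨x, hx, rfl⟩ := hx
    obtain ⟨-, hx⟩ := List.mem_filter.1 hx
    match x with
    | [] => simp at hx
    | d :: x =>
      obtain rfl : d = 0 := by simpa using hx
      exact ⟨_, rfl⟩
  have h2 : ∀ x ∈ S.filter (fun x => x.getLast? ≠ some 2),
      x ∈ S ∧ ∃ z, morphism a b c x = z ++ [a, b] := by
    intro x hx
    obtain ⟨hx, hx2⟩ := List.mem_filter.1 hx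
    refine ⟨hx, ?_⟩
    obtain ⟨z, ⟨-, hz⟩ | ⟨h, -⟩⟩ := exists_morphism_eq_concat a b c (hS.ne_nil hx)
    · exact ⟨z, hz⟩
    · simp [h] at hx2
  have h2' : ∀ x ∈ (S.filter (fun x => x.getLast? ≠ some 2)).map
      (fun x => rotRight (rotRight (morphism a b c x))), ∃ y, x = a :: b :: y := by
    intro x hx
    rw [List.mem_map] at hx
    obtain ⟨x, hx, rfl⟩ := hx
    obtain ⟨-, z, hz⟩ := h2 x hx
    exact ⟨z, by rw [hz, rotRight_rotRight_concat]⟩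
  refine List.pairwise_append.2 ⟨?_, List.pairwise_append.2 ⟨?_, hT, ?_⟩, ?_⟩
  · exact List.pairwise_map.2 ((hS.2.filter _).imp (morphism_lt_morphism hab hbc))
  · refine List.pairwise_map.2 ((hS.2.filter _).imp_of_mem fun {x y} hx hy hxy => ?_)
    obtain ⟨hx, z, hz⟩ := h2 x hx
    obtain ⟨hy, w, hw⟩ := h2 y hy
    have hlt := morphism_lt_morphism hab hbc hxy
    have hlen := hS.length_morphism_eq a b c hx hy
    rw [hz, hw] at hlt hlen
    rw [hz, hw, rotRight_rotRight_concat, rotRight_rotRight_concat]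
    have := lt_of_append_lt_append_right (by simpa using hlen) hlt
    simpa [List.cons_lt_cons_iff] using this
  · intro x hx y hy
    obtain ⟨z, rfl⟩ := h2' x hx
    exact ha y hy _
  · intro x hx y hy
    obtain ⟨z, rfl⟩ := h1 x hx
    rcases List.mem_append.1 hy with hy | hy
    · obtain ⟨w, rfl⟩ := h2' y hy
      simp [List.cons_lt_cons_iff, hab]
    · exact ha y hy _

/-- Sorted rotations of the image of `u` when `2` is mapped to the same letter `b` that ends the
images of `0` and `1`. -/
theorem IsSortedRotations.morphism_self (hS : IsSortedRotations u S) (hab : a < b) :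
    IsSortedRotations (morphism a b b u)
      ((S.filter (fun x => x.head? = some 0)).map (morphism a b b) ++
        ((S.filter (fun x => x.getLast? ≠ some 2)).map
            (fun x => rotRight (rotRight (morphism a b b x))) ++
          S.map (fun x => rotRight (morphism a b b x)))) := by
  refine ⟨(rotations_morphism_perm a b b hS.1).symm,
    pairwise_morphism_append hab le_rfl hS ?_ ?_⟩
  · exact List.pairwise_map.2 (hS.2.imp_of_mem fun hx hy h =>
      rotRight_morphism_lt hab le_rfl hS hx hy h (Or.inl rfl))
  · intro x hx y
    rw [List.mem_map] at hx
    obtain ⟨x, hx, rfl⟩ := hx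
    obtain ⟨z, ⟨-, h⟩ | ⟨-, h⟩⟩ := exists_rotRight_morphism_eq_cons hS a b b hx <;>
      simp [h, List.cons_lt_cons_iff, hab]

/-- Sorted rotations of the image of `u` when `2` is mapped to a letter `c` above `b`. -/
theorem IsSortedRotations.morphism_of_lt (hS : IsSortedRotations u S) (hab : a < b) (hbc : b < c) :
    IsSortedRotations (morphism a b c u)
      ((S.filter (fun x => x.head? = some 0)).map (morphism a b c) ++
        ((S.filter (fun x => x.getLast? ≠ some 2)).map
            (fun x => rotRight (rotRight (morphism a b c x))) ++
          ((S.filter (fun x => x.getLast? ≠ some 2)).map (fun x => rotRight (morphism a b c x)) ++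
            (S.filter (fun x => x.getLast? = some 2)).map
              (fun x => rotRight (morphism a b c x))))) := by
  have hperm : ((S.filter (fun x => x.getLast? ≠ some 2)) ++
      (S.filter (fun x => x.getLast? = some 2))).Perm S := by
    have := List.filter_append_perm (fun x : List (Fin 3) => decide (x.getLast? ≠ some 2)) S
    simpa using this
  have h1 : ∀ x ∈ S.filter (fun x => x.getLast? ≠ some 2),
      x ∈ S ∧ x.getLast? ≠ some 2 := by simp
  have h2 : ∀ x ∈ S.filter (fun x => x.getLast? = some 2),
      x ∈ S ∧ x.getLast? = some 2 := by simp
  refine ⟨List.Perm.trans ?_ (rotations_morphism_perm a b c hS.1).symm,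
    pairwise_morphism_append hab hbc.le hS (List.pairwise_append.2 ⟨?_, ?_, ?_⟩) ?_⟩
  · rw [← List.map_append]
    exact List.Perm.append_left _ (List.Perm.append_left _ (hperm.map _))
  · refine List.pairwise_map.2 ((hS.2.filter _).imp_of_mem fun {x y} hx hy h => ?_)
    obtain ⟨hx, hx2⟩ := h1 x hx
    obtain ⟨hy, hy2⟩ := h1 y hy
    exact rotRight_morphism_lt hab hbc.le hS hx hy h (Or.inr (by simp [hx2, hy2]))
  · refine List.pairwise_map.2 ((hS.2.filter _).imp_of_mem fun {x y} hx hy h => ?_)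
    obtain ⟨hx, hx2⟩ := h2 x hx
    obtain ⟨hy, hy2⟩ := h2 y hy
    exact rotRight_morphism_lt hab hbc.le hS hx hy h (Or.inr (by simp [hx2, hy2]))
  · intro x hx y hy
    rw [List.mem_map] at hx
    obtain ⟨x, hx, rfl⟩ := hx
    rw [List.mem_map] at hy
    obtain ⟨y, hy, rfl⟩ := hy
    obtain ⟨hx, hx2⟩ := h1 x hx
    obtain ⟨hy, hy2⟩ := h2 y hy
    obtain ⟨z, ⟨-, h⟩ | ⟨h, -⟩⟩ := exists_rotRight_morphism_eq_cons hS a b c hx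
    · obtain ⟨w, ⟨h', -⟩ | ⟨-, h'⟩⟩ := exists_rotRight_morphism_eq_cons hS a b c hy
      · exact absurd hy2 h'
      · rw [h, h', List.cons_lt_cons_iff]
        exact Or.inl hbc
    · exact absurd h hx2
  · intro x hx y
    rw [← List.map_append] at hx
    rw [List.mem_map] at hx
    obtain ⟨x, hx, rfl⟩ := hx
    obtain ⟨z, ⟨-, h⟩ | ⟨-, h⟩⟩ :=
      exists_rotRight_morphism_eq_cons hS a b c (hperm.subset hx) <;>
      simp [h, List.cons_lt_cons_iff, hab, hab.trans hbc]

end sorted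

/-! ### Runs -/

section runs

variable [DecidableEq α]

theorem runsCount_append_cons (l : List α) (x : α) (m : List α) :
    runsCount (l ++ x :: m) + 1 = runsCount (l ++ [x]) + runsCount (x :: m) := by
  induction l with
  | nil => simp [runsCount, add_comm]
  | cons c l ih =>
    cases l with
    | nil => simp [runsCount]; omega
    | cons d l =>
      simp only [List.cons_append, runsCount] at ih ⊢
      omega

theorem runsCount_cons_replicate_append (x : α) (n : ℕ) (l : List α) :
    runsCount (x :: (List.replicate n x ++ l)) = runsCount (x :: l) := by
  induction n with
  | zero => simp
  | succ n ih => simpa [List.replicate_succ, runsCount] using ih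

theorem runsCount_cons_replicate_succ_append {x y : α} (h : x ≠ y) (n : ℕ) (l : List α) :
    runsCount (x :: (List.replicate (n + 1) y ++ l)) = 1 + runsCount (y :: l) := by
  rw [List.replicate_succ, List.cons_append, runsCount, runsCount_cons_replicate_append]
  simp [h]

end runs

/-! ### Last letters of the sorted rotations -/

theorem filterMap_eq_replicate {β : Type*} {g : α → Option β} {l : List α} {d : β}
    (h : ∀ x ∈ l, g x = some d) : l.filterMap g = List.replicate l.length d := by
  induction l with
  | nil => simp
  | cons c l ih =>
    rw [List.filterMap_cons_some (h c (by simp)), ih fun x hx => h x (by simp [hx])]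
    rfl

/-- A word ending with `0`, or with `1` preceded by a letter other than `2`. -/
def EndsRegularly (x : List (Fin 3)) : Prop :=
  ∃ y, x = y ++ [0] ∨ ∃ d, d ≠ 2 ∧ x = y ++ [d, 1]

namespace EndsRegularly

variable {x : List (Fin 3)}

theorem getLast?_ne (h : EndsRegularly x) : x.getLast? ≠ some 2 := by
  obtain ⟨y, rfl | ⟨d, -, rfl⟩⟩ := h <;> simp

theorem morphism_eq (h : EndsRegularly x) (a b c : α) : ∃ y, morphism a b c x = y ++ [a, b] := by
  obtain ⟨y, rfl | ⟨d, -, rfl⟩⟩ := h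
  · exact ⟨morphism a b c y ++ [a], by simp⟩
  · exact ⟨morphism a b c (y ++ [d]), by
      rw [show y ++ [d, 1] = (y ++ [d]) ++ [1] by simp, morphism_append a b c (y ++ [d])]; rfl⟩

theorem rotRight_rotRight_morphism_eq (h : EndsRegularly x) (a b c : α) :
    ∃ y, (x.getLast? = some 0 ∧ rotRight (rotRight (morphism a b c x)) = y ++ [a]) ∨
      (x.getLast? = some 1 ∧ rotRight (rotRight (morphism a b c x)) = y ++ [a, b]) := by
  obtain ⟨y, rfl | ⟨d, hd, rfl⟩⟩ := h
  · refine ⟨a :: b :: morphism a b c y, Or.inl ⟨by simp, ?_⟩⟩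
    rw [show morphism a b c (y ++ [0]) = (morphism a b c y ++ [a]) ++ [a, b] by simp,
      rotRight_rotRight_concat]
    rfl
  · match d with
    | 0 =>
      refine ⟨a :: b :: (morphism a b c y ++ [a]), Or.inr ⟨by simp, ?_⟩⟩
      rw [show morphism a b c (y ++ [0, 1]) = (morphism a b c y ++ [a, a, b]) ++ [a, b] by simp,
        rotRight_rotRight_concat]
      simp
    | 1 =>
      refine ⟨a :: b :: morphism a b c y, Or.inr ⟨by simp, ?_⟩⟩
      rw [show morphism a b c (y ++ [1, 1]) = (morphism a b c y ++ [a, b]) ++ [a, b] by simp,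
        rotRight_rotRight_concat]
      simp
    | 2 => exact absurd rfl hd

theorem rotRight_morphism_eq (h : EndsRegularly x) (a b c : α) :
    ∃ y, rotRight (morphism a b c x) = y ++ [a] := by
  obtain ⟨y, hy⟩ := h.morphism_eq a b c
  refine ⟨b :: y, ?_⟩
  rw [hy, show y ++ [a, b] = y ++ [a] ++ [b] by simp, rotRight_concat]
  rfl

end EndsRegularly

/-- The collapse of the three-letter alphabet onto `{0, 1}`. -/
def collapse (a b : α) (d : Fin 3) : α := if d = 0 then a else b

section lastLetters

variable {T : List (List (Fin 3))}

theorem lastLetters_morphism (hT : ∀ x ∈ T, EndsRegularly x) (a b c : α) :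
    (T.map (morphism a b c)).filterMap List.getLast? = List.replicate T.length b := by
  rw [List.filterMap_map]
  refine filterMap_eq_replicate fun x hx => ?_
  obtain ⟨y, hy⟩ := (hT x hx).morphism_eq a b c
  simp [hy]

theorem lastLetters_rotRight_rotRight_morphism (hT : ∀ x ∈ T, EndsRegularly x) (a b c : α) :
    (T.map (fun x => rotRight (rotRight (morphism a b c x)))).filterMap List.getLast? =
      (T.filterMap List.getLast?).map (collapse a b) := by
  rw [List.filterMap_map, List.map_filterMap]
  refine List.filterMap_congr fun x hx => ?_
  obtain ⟨y, ⟨h, hy⟩ | ⟨h, hy⟩⟩ := (hT x hx).rotRight_rotRight_morphism_eq a b c <;>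
    simp [h, hy, collapse]

theorem lastLetters_rotRight_morphism (hT : ∀ x ∈ T, EndsRegularly x) (a b c : α) :
    (T.map (fun x => rotRight (morphism a b c x))).filterMap List.getLast? =
      List.replicate T.length a := by
  rw [List.filterMap_map]
  refine filterMap_eq_replicate fun x hx => ?_
  obtain ⟨y, hy⟩ := (hT x hx).rotRight_morphism_eq a b c
  simp [hy]

theorem filter_getLast?_ne (hT : ∀ x ∈ T, EndsRegularly x) :
    T.filter (fun x => x.getLast? ≠ some 2) = T :=
  List.filter_eq_self.2 fun x hx => by simpa using (hT x hx).getLast?_ne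

theorem filter_getLast?_eq (hT : ∀ x ∈ T, EndsRegularly x) :
    T.filter (fun x => x.getLast? = some 2) = [] :=
  List.filter_eq_nil_iff.2 fun x hx => by simpa using (hT x hx).getLast?_ne

theorem endsRegularly_of_mem_morphism_append (hT : ∀ x ∈ T, EndsRegularly x)
    {x : List (Fin 3)} (hx : x ∈ (T.filter (fun x => x.head? = some 0)).map (morphism 0 1 2) ++
      (T.map (fun x => rotRight (rotRight (morphism 0 1 2 x))) ++
        T.map (fun x => rotRight (morphism 0 1 2 x)))) : EndsRegularly x := by
  rw [List.mem_append, List.mem_append, List.mem_map, List.mem_map, List.mem_map] at hx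
  rcases hx with ⟨x, hx, rfl⟩ | ⟨x, hx, rfl⟩ | ⟨x, hx, rfl⟩
  · obtain ⟨y, hy⟩ := (hT x (List.mem_of_mem_filter hx)).morphism_eq (0 : Fin 3) 1 2
    exact ⟨y, Or.inr ⟨0, by decide, hy⟩⟩
  · obtain ⟨y, ⟨-, hy⟩ | ⟨-, hy⟩⟩ := (hT x hx).rotRight_rotRight_morphism_eq (0 : Fin 3) 1 2
    · exact ⟨y, Or.inl hy⟩
    · exact ⟨y, Or.inr ⟨0, by decide, hy⟩⟩
  · obtain ⟨y, hy⟩ := (hT x hx).rotRight_morphism_eq (0 : Fin 3) 1 2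
    exact ⟨y, Or.inl hy⟩

theorem exists_morphism_append_eq_cons {v : List (Fin 3)}
    (hT : ∀ x ∈ v :: T, EndsRegularly x) (hv : v.head? = some 0) {p q : ℕ}
    (hlast : (v :: T).filterMap List.getLast? =
      List.replicate (p + 1) 1 ++ List.replicate (q + 1) 0) (a b c : α) :
    ∃ T' p' q', ((v :: T).filter (fun x => x.head? = some 0)).map (morphism a b c) ++
        ((v :: T).map (fun x => rotRight (rotRight (morphism a b c x))) ++
          (v :: T).map (fun x => rotRight (morphism a b c x))) = morphism a b c v :: T' ∧
      (((v :: T).filter (fun x => x.head? = some 0)).map (morphism a b c) ++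
        ((v :: T).map (fun x => rotRight (rotRight (morphism a b c x))) ++
          (v :: T).map (fun x => rotRight (morphism a b c x)))).filterMap List.getLast? =
        List.replicate (p' + 1) b ++ List.replicate (q' + 1) a := by
  have hcons : (v :: T).filter (fun x => x.head? = some 0) =
      v :: T.filter (fun x => x.head? = some 0) := by
    simp [hv]
  refine ⟨_, (T.filter (fun x => x.head? = some 0)).length + p + 1, q + T.length + 1,
    by rw [hcons]; rfl, ?_⟩
  rw [List.filterMap_append, List.filterMap_append, lastLetters_morphism
    (fun x hx => hT x (List.mem_of_mem_filter (p := fun x => x.head? = some 0) hx)),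
    lastLetters_rotRight_rotRight_morphism hT, lastLetters_rotRight_morphism hT, hlast, hcons]
  simp only [List.map_append, List.map_replicate, List.length_cons, collapse, if_true,
    one_ne_zero, if_false]
  rw [← List.append_assoc, ← List.append_assoc, ← List.replicate_add, List.append_assoc,
    ← List.replicate_add]
  congr 2 <;> omega

end lastLetters

/-! ### The Lyndon rotations of the Fibonacci words of even order -/

/-- The Lyndon rotation of the Fibonacci word of order `2 * (k + 1)`. -/
def fibLyndon : ℕ → List (Fin 3)
  | 0 => [0, 1]
  | k + 1 => morphism 0 1 2 (fibLyndon k)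

theorem exists_fibLyndon_eq (k : ℕ) : ∃ t, fibLyndon k = 0 :: (t ++ [1]) := by
  induction k with
  | zero => exact ⟨[], rfl⟩
  | succ k ih =>
    obtain ⟨t, ht⟩ := ih
    exact ⟨0 :: 1 :: (morphism 0 1 2 t ++ [0]), by simp [fibLyndon, ht]⟩

theorem exists_sortedRotations_fibLyndon (k : ℕ) :
    ∃ S p q, IsSortedRotations (fibLyndon k) (fibLyndon k :: S) ∧
      (∀ x ∈ fibLyndon k :: S, EndsRegularly x) ∧
      (fibLyndon k :: S).filterMap List.getLast? =
        List.replicate (p + 1) 1 ++ List.replicate (q + 1) 0 := by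
  induction k with
  | zero =>
    refine ⟨[[1, 0]], 0, 0, ⟨by decide, by decide⟩, ?_, by decide⟩
    intro x hx
    simp only [fibLyndon, List.mem_cons, List.not_mem_nil, or_false] at hx
    rcases hx with rfl | rfl
    · exact ⟨[], Or.inr ⟨0, by decide, rfl⟩⟩
    · exact ⟨[1], Or.inl rfl⟩
  | succ k ih =>
    obtain ⟨S, p, q, hS, hreg, hlast⟩ := ih
    have h := hS.morphism_of_lt (a := (0 : Fin 3)) (b := 1) (c := 2) (by decide) (by decide)
    have hreg' := fun x hx => endsRegularly_of_mem_morphism_append hreg (x := x) hx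
    rw [filter_getLast?_ne hreg, filter_getLast?_eq hreg, List.map_nil, List.append_nil] at h
    obtain ⟨S', p', q', hl, hlast'⟩ := exists_morphism_append_eq_cons hreg
      (by obtain ⟨t, ht⟩ := exists_fibLyndon_eq k; simp [ht]) hlast (0 : Fin 3) 1 2
    rw [hl] at h hreg' hlast'
    exact ⟨S', p', q', h, hreg', hlast'⟩

theorem exists_sortedRotations_fibLyndon_append_two (k : ℕ) :
    ∃ S Q, IsSortedRotations (fibLyndon k ++ [2]) ((fibLyndon k ++ [2]) :: S) ∧
      (∀ x ∈ S, EndsRegularly x) ∧ S ≠ [] ∧ S.filterMap List.getLast? = Q ++ [1] ∧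
      runsCount (1 :: (Q ++ [1]).map (collapse (0 : Fin 2) 1)) = 2 * k + 3 := by
  induction k with
  | zero =>
    refine ⟨[[1, 2, 0], [2, 0, 1]], [0], ⟨by decide, by decide⟩, ?_, by decide, by decide,
      by decide⟩
    intro x hx
    simp only [List.mem_cons, List.not_mem_nil, or_false] at hx
    rcases hx with rfl | rfl
    · exact ⟨[1, 2], Or.inl rfl⟩
    · exact ⟨[2], Or.inr ⟨0, by decide, rfl⟩⟩
  | succ k ih =>
    obtain ⟨S, Q, hS, hreg, hne, hlast, hruns⟩ := ih
    obtain ⟨t, ht⟩ := exists_fibLyndon_eq k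
    have h := hS.morphism_of_lt (a := (0 : Fin 3)) (b := 1) (c := 2) (by decide) (by decide)
    have hlast' := lastLetters_morphism
      (fun x hx => hreg x (List.mem_of_mem_filter (p := fun x => x.head? = some 0) hx))
      (0 : Fin 3) 1 2
    have hlast2 := lastLetters_rotRight_rotRight_morphism hreg (0 : Fin 3) 1 2
    have hlast3 := lastLetters_rotRight_morphism hreg (0 : Fin 3) 1 2
    have f1 : ((fibLyndon k ++ [2]) :: S).filter (fun x => x.head? = some 0) =
        (fibLyndon k ++ [2]) :: S.filter (fun x => x.head? = some 0) := by
      simp [ht]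
    have f2 : ((fibLyndon k ++ [2]) :: S).filter (fun x => x.getLast? ≠ some 2) = S := by
      rw [List.filter_cons, filter_getLast?_ne hreg]
      simp
    have f3 : ((fibLyndon k ++ [2]) :: S).filter (fun x => x.getLast? = some 2) =
        [fibLyndon k ++ [2]] := by
      rw [List.filter_cons, filter_getLast?_eq hreg]
      simp
    have e : morphism (0 : Fin 3) 1 2 (fibLyndon k ++ [2]) = fibLyndon (k + 1) ++ [2] := by
      simp [fibLyndon]
    obtain ⟨y, e'⟩ : ∃ y, rotRight (morphism (0 : Fin 3) 1 2 (fibLyndon k ++ [2])) =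
        y ++ [0, 1] := by
      refine ⟨2 :: 0 :: 0 :: 1 :: morphism 0 1 2 t, ?_⟩
      rw [e, rotRight_concat]
      simp [fibLyndon, ht]
    rw [f1, f2, f3, List.map_cons, List.map_singleton, e', e, List.cons_append] at h
    refine ⟨_, List.replicate (S.filter (fun x => x.head? = some 0)).length 1 ++
      ((Q ++ [1]).map (collapse 0 1) ++ List.replicate S.length 0), h, ?_, ?_, ?_, ?_⟩
    · intro x hx
      rw [← List.append_assoc, ← List.append_assoc] at hx
      rcases List.mem_append.1 hx with hx | hx
      · rw [List.append_assoc] at hx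
        exact endsRegularly_of_mem_morphism_append hreg hx
      · rw [List.mem_singleton] at hx
        exact ⟨_, Or.inr ⟨0, by decide, hx⟩⟩
    · simp
    · rw [List.filterMap_append, List.filterMap_append, List.filterMap_append, hlast', hlast2,
        hlast3, hlast]
      simp [collapse]
    · obtain ⟨n, hn⟩ : ∃ n, S.length = n + 1 :=
        Nat.exists_eq_succ_of_ne_zero (by simpa using hne)
      have hcomp : collapse (0 : Fin 2) 1 ∘ collapse (0 : Fin 3) 1 = collapse 0 1 := by decide
      have h1 := runsCount_append_cons (1 :: Q.map (collapse (0 : Fin 2) 1)) 1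
        (List.replicate (n + 1) 0 ++ [1])
      rw [runsCount_cons_replicate_succ_append (by decide)] at h1
      have h2 : runsCount (1 :: (Q.map (collapse (0 : Fin 2) 1) ++ [1])) = 2 * k + 3 := by
        simpa [collapse] using hruns
      have h3 : (1 : Fin 2) :: ((List.replicate (S.filter
            (fun x : List (Fin 3) => x.head? = some 0)).length (1 : Fin 3) ++
          ((Q ++ [1]).map (collapse (0 : Fin 3) 1) ++ List.replicate S.length (0 : Fin 3))) ++
          [(1 : Fin 3)]).map
            (collapse (0 : Fin 2) 1) =
          1 :: (List.replicate (S.filter (fun x : List (Fin 3) => x.head? = some 0)).length 1 ++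
            (Q.map (collapse (0 : Fin 2) 1) ++ 1 :: (List.replicate (n + 1) 0 ++ [1]))) := by
        simp only [List.map_append, List.map_map, hcomp, hn, List.map_replicate, List.append_assoc]
        simp [collapse]
      rw [h3, runsCount_cons_replicate_append]
      simp only [List.cons_append] at h1
      rw [h2, show runsCount [(0 : Fin 2), 1] = 2 from rfl] at h1
      omega

/-! ### Fibonacci words -/

theorem append_morphism_fibWordG (a b c : α) (n : ℕ) :
    [a, b] ++ morphism a b c (fibWordG 0 1 n) = fibWordG a b (n + 2) ++ [a, b] := by
  induction n using Nat.twoStepInduction with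
  | zero => rfl
  | one => rfl
  | more n ih1 ih2 =>
    rw [fibWordG, morphism_append, ← List.append_assoc, ih2, List.append_assoc, ih1,
      ← List.append_assoc]
    rfl

theorem length_fibWordG_pos (a b : α) (n : ℕ) : 0 < (fibWordG a b n).length := by
  induction n using Nat.twoStepInduction with
  | zero => simp [fibWordG]
  | one => simp [fibWordG]
  | more n ih1 ih2 => simp [fibWordG]; omega

theorem isRotated_of_append_eq_append {u x y : List α} (h : u ++ x = y ++ u)
    (hl : u.length ≤ y.length) : y ~r x := by
  rcases List.append_eq_append_iff.1 h with ⟨z, rfl, rfl⟩ | ⟨z, h1, h2⟩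
  · exact List.isRotated_append
  · obtain rfl : z = [] := by
      have := congrArg List.length h1
      rw [List.length_append] at this
      exact List.eq_nil_of_length_eq_zero (by omega)
    rw [List.append_nil] at h1
    rw [List.nil_append] at h2
    rw [← h1, ← h2]

theorem fibWordG_isRotated_morphism (a b c : α) (n : ℕ) :
    fibWordG a b (n + 2) ~r morphism a b c (fibWordG 0 1 n) := by
  refine isRotated_of_append_eq_append (append_morphism_fibWordG a b c n) ?_
  have h1 := length_fibWordG_pos a b n
  have h2 := length_fibWordG_pos a b (n + 1)
  simp only [fibWordG, List.length_append, List.length_cons, List.length_nil]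
  omega

theorem fibWordG_isRotated_fibLyndon (k : ℕ) : fibWordG 0 1 (2 * k + 2) ~r fibLyndon k := by
  induction k with
  | zero => rfl
  | succ k ih =>
    exact (fibWordG_isRotated_morphism 0 1 2 (2 * k + 2)).trans (morphism_isRotated 0 1 2 ih)

theorem fibWord_isRotated (k : ℕ) :
    fibWord (2 * (k + 2)) ~r morphism 0 1 1 (fibLyndon k) :=
  (fibWordG_isRotated_morphism 0 1 1 (2 * k + 2)).trans
    (morphism_isRotated 0 1 1 (fibWordG_isRotated_fibLyndon k))

theorem length_fibWord_pos (n : ℕ) : 0 < (fibWord n).length :=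
  length_fibWordG_pos 0 1 n

theorem length_fibWord_add_two (n : ℕ) :
    (fibWord (n + 2)).length = (fibWord (n + 1)).length + (fibWord n).length := by
  simp [fibWord, fibWordG]

theorem length_fibWord_succ_le (n : ℕ) : (fibWord (n + 1)).length + 1 ≤ 2 ^ (n + 1) := by
  induction n using Nat.twoStepInduction with
  | zero => decide
  | one => decide
  | more n ih1 ih2 =>
    rw [length_fibWord_add_two]
    have h1 : 2 ^ (n + 1 + 1) = 2 * 2 ^ (n + 1) := pow_succ' 2 (n + 1)
    have h2 : 2 ^ (n + 2 + 1) = 2 * 2 ^ (n + 1 + 1) := pow_succ' 2 (n + 2)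
    omega

theorem exists_sortedRotations_morphism_fibLyndon (k : ℕ) :
    ∃ S p q, IsSortedRotations (morphism (0 : Fin 2) 1 1 (fibLyndon k))
        (morphism 0 1 1 (fibLyndon k) :: S) ∧
      (morphism (0 : Fin 2) 1 1 (fibLyndon k) :: S).filterMap List.getLast? =
        List.replicate (p + 1) 1 ++ List.replicate (q + 1) 0 := by
  obtain ⟨S, p, q, hS, hreg, hlast⟩ := exists_sortedRotations_fibLyndon k
  have h := hS.morphism_self (a := (0 : Fin 2)) (b := 1) (by decide)
  rw [filter_getLast?_ne hreg] at h
  obtain ⟨S', p', q', hl, hlast'⟩ := exists_morphism_append_eq_cons hreg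
    (by obtain ⟨t, ht⟩ := exists_fibLyndon_eq k; simp [ht]) hlast (0 : Fin 2) 1 1
  rw [hl] at h hlast'
  exact ⟨S', p', q', h, hlast'⟩

theorem lexMinRotation_fibWord (k : ℕ) :
    lexMinRotation (fibWord (2 * (k + 2))) = morphism 0 1 1 (fibLyndon k) := by
  obtain ⟨S, -, -, hS, -⟩ := exists_sortedRotations_morphism_fibLyndon k
  rw [lexMinRotation, insertionSort_eq_of_perm
    ((rotations_perm_of_isRotated (fibWord_isRotated k)).trans hS.1.symm) hS.2]
  rfl

theorem runsCount_BWT (k : ℕ) :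
    runsCount (BWT (1 :: morphism (0 : Fin 2) 1 1 (fibLyndon k))) = 2 * k + 4 := by
  obtain ⟨S, Q, hS, hreg, hne, hlast, hruns⟩ := exists_sortedRotations_fibLyndon_append_two k
  obtain ⟨t, ht⟩ := exists_fibLyndon_eq k
  have h := hS.morphism_self (a := (0 : Fin 2)) (b := 1) (by decide)
  have f1 : ((fibLyndon k ++ [2]) :: S).filter (fun x => x.head? = some 0) =
      (fibLyndon k ++ [2]) :: S.filter (fun x => x.head? = some 0) := by
    simp [ht]
  have f2 : ((fibLyndon k ++ [2]) :: S).filter (fun x => x.getLast? ≠ some 2) = S := by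
    rw [List.filter_cons, filter_getLast?_ne hreg]
    simp
  have e : morphism (0 : Fin 2) 1 1 (fibLyndon k ++ [2]) =
      morphism 0 1 1 (fibLyndon k) ++ [1] := by
    simp
  have e' : rotRight (morphism (0 : Fin 2) 1 1 (fibLyndon k ++ [2])) =
      (1 :: morphism 0 1 1 (0 :: t) ++ [0]) ++ [1] := by
    rw [e, rotRight_concat]
    simp [ht]
  have hrot : (1 :: morphism (0 : Fin 2) 1 1 (fibLyndon k)) ~r
      morphism 0 1 1 (fibLyndon k ++ [2]) := by
    rw [e]
    exact List.isRotated_append (l := [1])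
  rw [BWT, insertionSort_eq_of_perm ((rotations_perm_of_isRotated hrot).trans h.1.symm) h.2,
    f1, f2, List.map_cons, List.map_cons, List.filterMap_append, List.filterMap_append,
    List.filterMap_cons_some (b := 1) (by rw [e, List.getLast?_concat]),
    List.filterMap_cons_some (b := 1) (by rw [e', List.getLast?_concat]),
    lastLetters_morphism
      (fun x hx => hreg x (List.mem_of_mem_filter (p := fun x => x.head? = some 0) hx)),
    lastLetters_rotRight_rotRight_morphism hreg, lastLetters_rotRight_morphism hreg, hlast,
    List.cons_append, runsCount_cons_replicate_append]
  obtain ⟨n, hn⟩ : ∃ n, S.length = n + 1 :=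
    Nat.exists_eq_succ_of_ne_zero (by simpa using hne)
  have h1 := runsCount_append_cons (1 :: (Q ++ [1]).map (collapse (0 : Fin 2) 1)) 1
    (List.replicate (n + 1) 0)
  have h2 := runsCount_append_cons (1 :: Q.map (collapse (0 : Fin 2) 1)) 1 [1]
  have h3 := runsCount_cons_replicate_succ_append (show (1 : Fin 2) ≠ 0 by decide) n []
  rw [List.append_nil] at h3
  have h4 : (1 :: Q.map (collapse (0 : Fin 2) 1)) ++ [1] =
      1 :: (Q ++ [1]).map (collapse (0 : Fin 2) 1) := by
    simp [collapse]
  have h5 : (1 :: (Q ++ [1]).map (collapse (0 : Fin 2) 1)) ++ [1] =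
      (1 :: Q.map (collapse (0 : Fin 2) 1)) ++ [1, 1] := by
    simp [collapse]
  rw [h3, h5] at h1
  rw [h4, hruns, show runsCount [(1 : Fin 2), 1] = 1 from rfl] at h2
  rw [show runsCount [(0 : Fin 2)] = 1 from rfl] at h1
  rw [hn]
  simp only [List.cons_append] at h1 h2 ⊢
  omega

/-! ### Lyndon factorization and the bijective transform -/

theorem IsSortedRotations.isLyndon [LinearOrder α] {u : List α} {S : List (List α)}
    (hS : IsSortedRotations u (u :: S)) : IsLyndon u := by
  refine ⟨hS.ne_nil (by simp), fun i hi hpos => ?_⟩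
  obtain ⟨n, hn⟩ := Nat.exists_eq_succ_of_ne_zero (show u.length ≠ 0 by omega)
  have hp := hS.1
  rw [rotations, hn, Nat.succ_eq_add_one, List.range_succ_eq_map, List.map_cons,
    Function.iterate_zero, id] at hp
  refine (List.pairwise_cons.1 hS.2).1 _ (hp.cons_inv.symm.subset ?_)
  rw [List.map_map, List.mem_map]
  obtain ⟨j, rfl⟩ := Nat.exists_eq_succ_of_ne_zero hpos.ne'
  exact ⟨j, by rw [List.mem_range]; omega, rfl⟩

theorem firstLyndonFactor_append [LinearOrder α] {p s : List α} (hp : IsLyndon p)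
    (h : ∀ i < s.length, ¬ IsLyndon ((p ++ s).take (p.length + 1 + i))) :
    firstLyndonFactor (p ++ s) = p := by
  have hnil : List.filter (fun x => decide (IsLyndon x)) (List.map
      ((fun i => (p ++ s).take i) ∘ fun x => p.length + 1 + x) (List.range s.length)) = [] := by
    refine List.filter_eq_nil_iff.2 fun x hx => ?_
    obtain ⟨i, hi, rfl⟩ := List.mem_map.1 hx
    simpa using h i (List.mem_range.1 hi)
  rw [firstLyndonFactor, List.length_append,
    show p.length + s.length + 1 = p.length + 1 + s.length by omega, List.range_add,
    List.map_append, List.filter_append, List.map_map, hnil, List.append_nil,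
    List.range_succ, List.map_append, List.filter_append, List.map_singleton, List.take_left,
    List.filter_cons_of_pos (by simpa using hp), List.filter_nil, List.getLastD_concat]

theorem isLyndon_singleton [LinearOrder α] (c : α) : IsLyndon [c] :=
  ⟨by simp, fun i hi hpos => by simp at hi; omega⟩

theorem not_isLyndon_cons_cons [LinearOrder α] {c d : α} (h : d < c) (x : List α) :
    ¬ IsLyndon (c :: d :: x) := by
  intro hL
  have := hL.2 1 (by simp) one_pos
  rw [Function.iterate_one, rot_cons, List.cons_append, List.cons_lt_cons_iff] at this
  rcases this with h' | ⟨h', -⟩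
  · exact lt_asymm h h'
  · exact h.ne' h'

theorem lyndonFactorization_cons [LinearOrder α] {c d : α} (h : d < c) {t : List α}
    (hL : IsLyndon (d :: t)) : lyndonFactorization (c :: d :: t) = [[c], d :: t] := by
  have h1 : firstLyndonFactor (c :: d :: t) = [c] := by
    refine firstLyndonFactor_append (s := d :: t) (isLyndon_singleton c) fun i _ => ?_
    rw [List.length_singleton, show 1 + 1 + i = i + 1 + 1 by omega]
    exact not_isLyndon_cons_cons h _
  have h2 : firstLyndonFactor (d :: t) = d :: t := by
    have := firstLyndonFactor_append (s := []) hL (by simp)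
    rwa [List.append_nil] at this
  simp [lyndonFactorization, lyndonFactAux, h1, h2]
  cases t.length <;> rfl

theorem omegaLE_iff_of_length_eq [LinearOrder α] {x y : List α} (hl : x.length = y.length)
    (hx : x ≠ []) : omegaLE x y ↔ x ≤ y := by
  have key : ∀ {x y : List α}, x.length = y.length → x ≠ [] → x < y →
      listPow x y.length < listPow y x.length := by
    intro x y hl hx h
    obtain ⟨n, hn⟩ := Nat.exists_eq_succ_of_ne_zero (by simpa using hx : x.length ≠ 0)
    rw [← hl, hn]
    exact append_lt_append_of_length_eq hl h _ _
  constructor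
  · intro h
    by_contra! hlt
    exact not_le_of_gt (key hl.symm (by rintro rfl; simp at hl; exact hx hl) hlt) h
  · intro h
    rcases h.lt_or_eq with h | rfl
    · exact (key hl hx h).le
    · exact le_refl _

theorem lt_listPow_of_zero_mem {y : List (Fin 2)} (h : 0 ∈ y) : y < listPow [1] y.length := by
  induction y with
  | nil => simp at h
  | cons d y ih =>
    rw [List.length_cons, listPow, List.singleton_append, List.cons_lt_cons_iff]
    match d with
    | 0 => exact Or.inl (by decide)
    | 1 => exact Or.inr ⟨rfl, ih (by simpa using h)⟩

theorem orderedInsert_eq_concat {r : α → α → Prop} [DecidableRel r] {c : α} {l : List α}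
    (h : ∀ x ∈ l, ¬ r c x) : List.orderedInsert r c l = l ++ [c] := by
  induction l with
  | nil => rfl
  | cons d l ih =>
    rw [List.orderedInsert_cons, if_neg (h d (by simp)), ih fun x hx => h x (by simp [hx])]
    rfl

theorem IsSortedRotations.insertionSort_omegaLE [LinearOrder α] {u : List α} {S : List (List α)}
    (hS : IsSortedRotations u S) : List.insertionSort omegaLE (rotations u) = S := by
  have h := List.map_insertionSort omegaLE (· ≤ ·) id (rotations u) fun x hx y hy =>
    omegaLE_iff_of_length_eq
      ((isRotated_of_mem_rotations hx).symm.trans (isRotated_of_mem_rotations hy)).perm.length_eq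
      (hS.ne_nil (hS.1.symm.subset hx))
  rw [List.map_id, List.map_id, insertionSort_eq_of_perm hS.1.symm hS.2] at h
  exact h

theorem runsCount_BBWT (k : ℕ) :
    runsCount (BBWT (1 :: morphism (0 : Fin 2) 1 1 (fibLyndon k))) = 3 := by
  obtain ⟨S, p, q, hS, hlast⟩ := exists_sortedRotations_morphism_fibLyndon k
  obtain ⟨t, ht⟩ : ∃ t, morphism (0 : Fin 2) 1 1 (fibLyndon k) = 0 :: t := by
    obtain ⟨t, ht⟩ := exists_fibLyndon_eq k
    exact ⟨_, by rw [ht]; rfl⟩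
  rw [ht] at hS hlast ⊢
  have hnot : ∀ x ∈ (0 :: t) :: S, ¬ omegaLE [1] x := by
    intro x hx hle
    have h0 : 0 ∈ x := (hS.isRotated hx).perm.subset (by simp)
    refine not_le_of_gt (lt_listPow_of_zero_mem h0) ?_
    simpa [omegaLE, listPow] using hle
  have hfact : ((lyndonFactorization (1 :: 0 :: t)).map rotations).flatten =
      [1] :: rotations ((0 : Fin 2) :: t) := by
    rw [lyndonFactorization_cons (by decide) hS.isLyndon]
    simp [rotations]
  rw [BBWT, hfact, List.insertionSort_cons, hS.insertionSort_omegaLE,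
    orderedInsert_eq_concat hnot, List.filterMap_append, hlast, List.append_assoc,
    List.replicate_succ, List.cons_append, runsCount_cons_replicate_append,
    runsCount_cons_replicate_succ_append (by decide)]
  rfl

theorem logb_length_fibWord_le (n : ℕ) :
    Real.logb 2 (((fibWord (n + 1)).length + 1 : ℕ) : ℝ) ≤ ((n + 1 : ℕ) : ℝ) := by
  rw [Real.logb_le_iff_le_rpow (by norm_num) (by positivity), Real.rpow_natCast]
  exact_mod_cast length_fibWord_succ_le n

/-- there are a constant `c > 0` and infinitely many lengths `n`
admitting a string `w` of length `n` with `r(w) ≥ c · r_B(w) · log₂ n`;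
concretely, for every `k ≥ 3` the string `w_k = b · F*_{2k}` has length
`f_{2k} + 1`, `r_B(w_k) = 3` and `r(w_k) = 2k`. -/
theorem stmt0 :
    (∃ c : ℝ, 0 < c ∧
      {n : ℕ | ∃ w : List (Fin 2), w.length = n ∧
        c * (runsCount (BBWT w) : ℝ) * Real.logb 2 (n : ℝ) ≤
          (runsCount (BWT w) : ℝ)}.Infinite) ∧
    ∀ k : ℕ, 3 ≤ k →
      (1 :: lexMinRotation (fibWord (2 * k))).length = (fibWord (2 * k)).length + 1 ∧
      runsCount (BBWT (1 :: lexMinRotation (fibWord (2 * k)))) = 3 ∧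
      runsCount (BWT (1 :: lexMinRotation (fibWord (2 * k)))) = 2 * k := by
  have h : ∀ k : ℕ, 3 ≤ k →
      (1 :: lexMinRotation (fibWord (2 * k))).length = (fibWord (2 * k)).length + 1 ∧
      runsCount (BBWT (1 :: lexMinRotation (fibWord (2 * k)))) = 3 ∧
      runsCount (BWT (1 :: lexMinRotation (fibWord (2 * k)))) = 2 * k := by
    intro k hk
    obtain ⟨m, rfl⟩ := Nat.exists_eq_add_of_le' (show 2 ≤ k by omega)
    refine ⟨?_, ?_, ?_⟩
    · rw [lexMinRotation_fibWord, List.length_cons, (fibWord_isRotated m).perm.length_eq]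
    · rw [lexMinRotation_fibWord, runsCount_BBWT]
    · rw [lexMinRotation_fibWord, runsCount_BWT]
      ring
  refine ⟨⟨1 / 3, by norm_num, ?_⟩, h⟩
  refine Set.infinite_of_injective_forall_mem (f := fun k => (fibWord (2 * (k + 3))).length + 1)
    (StrictMono.injective (strictMono_nat_of_lt_succ fun k => ?_)) fun k => ?_
  · have h1 := length_fibWord_add_two (2 * (k + 3))
    have h2 := length_fibWord_pos (2 * (k + 3) + 1)
    rw [show 2 * (k + 1 + 3) = 2 * (k + 3) + 2 by ring]
    omega
  · obtain ⟨h1, h2, h3⟩ := h (k + 3) (by omega)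
    refine ⟨_, h1, ?_⟩
    rw [h2, h3]
    have h4 := logb_length_fibWord_le (2 * k + 5)
    rw [show 2 * k + 5 + 1 = 2 * (k + 3) by ring] at h4
    push_cast at h4 ⊢
    linarith
end

section
/- For every integer k ≥ 1, the lexicographically smallest rotation of the Fibonacci word F_{2k} is F*_{2k} = rot^{f_{2k-1} - 1}(F_{2k}). -/
/-! Basic definitions: strings as `List α`, rotations, runs, BWT, Lyndon
factorization, ω-order, bijective BWT, and Fibonacci words. -/

variable {α : Type*}

theorem rot_iterate_eq_rotate (x : List α) (n : ℕ) : rot^[n] x = x.rotate n := by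
  induction n with
  | zero => simp
  | succ n ih => rw [Function.iterate_succ_apply', ih, rot_eq_rotate, List.rotate_rotate]

theorem lexMinRotation_eq_of_isLeast [LinearOrder α] {x w : List α}
    (hw : w ∈ rotations x) (hle : ∀ v ∈ rotations x, w ≤ v) : lexMinRotation x = w := by
  have hs := List.pairwise_insertionSort (· ≤ ·) (rotations x)
  have hm : ∀ v, v ∈ List.insertionSort (· ≤ ·) (rotations x) ↔ v ∈ rotations x :=
    fun v => List.mem_insertionSort _
  unfold lexMinRotation
  cases h : List.insertionSort (· ≤ ·) (rotations x) with
  | nil =>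
    rw [h] at hm
    exact absurd ((hm w).2 hw) List.not_mem_nil
  | cons y l =>
    rw [h] at hm hs
    have hy : w ≤ y := hle y ((hm y).1 List.mem_cons_self)
    rcases List.mem_cons.1 ((hm w).2 hw) with rfl | hl
    · rfl
    · exact le_antisymm ((List.pairwise_cons.1 hs).1 w hl) hy

/-- The square of the Fibonacci morphism: `a ↦ aba`, `b ↦ ab`. -/
def fibSq (c : Fin 2) : List (Fin 2) := if c = 0 then [0, 1, 0] else [0, 1]

/-- The conjugate of `fibSq` given by `a ↦ aab`, `b ↦ ab`, which preserves Lyndon words. -/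
def lyndonSub (c : Fin 2) : List (Fin 2) := if c = 0 then [0, 0, 1] else [0, 1]

theorem fibWord_add_two (n : ℕ) : fibWord (n + 2) = fibWord (n + 1) ++ fibWord n := rfl

theorem flatMap_fibSq_fibWord (n : ℕ) : (fibWord n).flatMap fibSq = fibWord (n + 2) := by
  induction n using Nat.twoStepInduction with
  | zero => decide
  | one => decide
  | more n ih₁ ih₂ =>
    rw [fibWord_add_two n, List.flatMap_append, ih₁, ih₂, fibWord_add_two (n + 2)]

theorem flatMap_fibSq_append (x : List (Fin 2)) :
    x.flatMap fibSq ++ [0, 1] = [0, 1] ++ x.flatMap lyndonSub := by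
  induction x with
  | nil => rfl
  | cons c x ih =>
    rw [List.flatMap_cons, List.append_assoc, ih, List.flatMap_cons]
    fin_cases c <;> simp [fibSq, lyndonSub]

theorem flatMap_lyndonSub_append {x y : List (Fin 2)} (h : x ++ [0] = 0 :: y) :
    x.flatMap lyndonSub ++ [0] = 0 :: y.flatMap fibSq := by
  have h₁ := congrArg (List.flatMap lyndonSub) h
  have h₂ := flatMap_fibSq_append y
  simp only [List.flatMap_append, List.flatMap_cons, List.flatMap_nil, lyndonSub, if_true] at h₁
  have h₃ : (x.flatMap lyndonSub ++ [0]) ++ [0, 1] = (0 :: y.flatMap fibSq) ++ [0, 1] := by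
    rw [List.cons_append, h₂]
    simpa [lyndonSub] using h₁
  exact List.append_cancel_right h₃

theorem list_nil_le [LinearOrder α] (x : List α) : [] ≤ x :=
  not_lt.1 (List.not_lt_nil x)

theorem list_cons_le_cons_iff [LinearOrder α] {a b : α} {x y : List α} :
    a :: x ≤ b :: y ↔ a < b ∨ a = b ∧ x ≤ y := by
  rw [← not_lt, List.cons_lt_cons_iff, not_or, not_lt, not_and, not_lt, le_iff_lt_or_eq]
  constructor
  · rintro ⟨h | rfl, h'⟩
    · exact Or.inl h
    · exact Or.inr ⟨rfl, h' rfl⟩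
  · rintro (h | ⟨rfl, h⟩)
    · exact ⟨Or.inl h, fun h' => absurd h' h.ne'⟩
    · exact ⟨Or.inr rfl, fun _ => h⟩

theorem flatMap_lyndonSub_mono {x y : List (Fin 2)} (h : x ≤ y) :
    x.flatMap lyndonSub ≤ y.flatMap lyndonSub := by
  induction x generalizing y with
  | nil => exact list_nil_le _
  | cons c x ih =>
    cases y with
    | nil => exact absurd (le_antisymm h (list_nil_le _)) (by simp)
    | cons d y =>
      rw [list_cons_le_cons_iff] at h
      rcases h with h | ⟨rfl, h⟩
      · obtain ⟨rfl, rfl⟩ : c = 0 ∧ d = 1 := by omega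
        simp [lyndonSub, list_cons_le_cons_iff]
      · have := ih h
        fin_cases c <;> simpa [lyndonSub, list_cons_le_cons_iff] using this

/-- A cut of `x.flatMap lyndonSub` is at a block boundary or is followed by `ab` or `b`. -/
theorem flatMap_lyndonSub_eq_append {x s t : List (Fin 2)} (h : x.flatMap lyndonSub = s ++ t) :
    (∃ u v, x = u ++ v ∧ s = u.flatMap lyndonSub ∧ t = v.flatMap lyndonSub) ∨
      (∃ r, t = 0 :: 1 :: r) ∨ ∃ r, t = 1 :: r := by
  induction x generalizing s with
  | nil =>
    obtain ⟨rfl, rfl⟩ : s = [] ∧ t = [] := by simpa using h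
    exact Or.inl ⟨[], [], rfl, rfl, rfl⟩
  | cons c x ih =>
    rw [List.flatMap_cons, List.append_eq_append_iff] at h
    rcases h with ⟨s', rfl, h⟩ | ⟨r, hr, rfl⟩
    · rcases ih h with ⟨u, v, rfl, rfl, rfl⟩ | h
      · exact Or.inl ⟨c :: u, v, rfl, rfl, rfl⟩
      · exact Or.inr h
    · rcases s with _ | ⟨s₀, s⟩
      · refine Or.inl ⟨[], c :: x, rfl, rfl, ?_⟩
        rw [List.flatMap_cons, hr, List.nil_append]
      · by_cases hr' : r = []
        · subst hr'
          refine Or.inl ⟨[c], x, rfl, ?_, rfl⟩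
          simpa using hr.symm
        · right
          fin_cases c
          · rcases s with _ | ⟨s₁, _ | ⟨s₂, s⟩⟩
            · obtain ⟨-, rfl⟩ : 0 = s₀ ∧ [0, 1] = r := by simpa [lyndonSub] using hr
              exact Or.inl ⟨_, rfl⟩
            · obtain ⟨-, -, rfl⟩ : 0 = s₀ ∧ 0 = s₁ ∧ [1] = r := by simpa [lyndonSub] using hr
              exact Or.inr ⟨_, rfl⟩
            · obtain ⟨-, -, -, -, h⟩ : 0 = s₀ ∧ 0 = s₁ ∧ 1 = s₂ ∧ s = [] ∧ r = [] := by
                simpa [lyndonSub] using hr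
              exact absurd h hr'
          · rcases s with _ | ⟨s₁, s⟩
            · obtain ⟨-, rfl⟩ : 0 = s₀ ∧ [1] = r := by simpa [lyndonSub] using hr
              exact Or.inr ⟨_, rfl⟩
            · obtain ⟨-, -, -, h⟩ : 0 = s₀ ∧ 1 = s₁ ∧ s = [] ∧ r = [] := by
                simpa [lyndonSub] using hr
              exact absurd h hr'

theorem flatMap_lyndonSub_le_rotation {x : List (Fin 2)}
    (h : ∀ s t, 0 :: x = s ++ t → 0 :: x ≤ t ++ s) (s t : List (Fin 2))
    (hst : (0 :: x).flatMap lyndonSub = s ++ t) : (0 :: x).flatMap lyndonSub ≤ t ++ s := by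
  rcases flatMap_lyndonSub_eq_append hst with ⟨u, v, huv, rfl, rfl⟩ | ⟨r, rfl⟩ | ⟨r, rfl⟩
  · rw [← List.flatMap_append]
    exact flatMap_lyndonSub_mono (h u v huv)
  · simp [lyndonSub, list_cons_le_cons_iff]
  · simp [lyndonSub, list_cons_le_cons_iff]

theorem exists_fibWord_odd_eq_append (j : ℕ) :
    ∃ q, fibWord (2 * j + 1) = q ++ [0] ∧
      ∀ s t, 0 :: (fibWord (2 * j) ++ q) = s ++ t →
        0 :: (fibWord (2 * j) ++ q) ≤ t ++ s := by
  induction j with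
  | zero =>
    refine ⟨[], rfl, fun s t h => ?_⟩
    change [0, 1] = s ++ t at h
    change [0, 1] ≤ t ++ s
    rcases s with _ | ⟨a, _ | ⟨b, s⟩⟩
    · simp_all
    · obtain ⟨rfl, rfl⟩ : 0 = a ∧ [1] = t := by simpa using h
      decide
    · obtain ⟨rfl, rfl, rfl, rfl⟩ : 0 = a ∧ 1 = b ∧ s = [] ∧ t = [] := by simpa using h
      decide
  | succ j ih =>
    obtain ⟨q, hq, hmin⟩ := ih
    have hq' : fibWord (2 * (j + 1) + 1) = (fibWord (2 * j + 2) ++ q) ++ [0] := by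
      rw [List.append_assoc, ← hq]
      rfl
    refine ⟨fibWord (2 * j + 2) ++ q, hq', ?_⟩
    have key : (0 :: (fibWord (2 * j) ++ q)).flatMap lyndonSub =
        0 :: (fibWord (2 * (j + 1)) ++ (fibWord (2 * j + 2) ++ q)) := by
      apply List.append_cancel_right (bs := [0])
      rw [flatMap_lyndonSub_append (y := fibWord (2 * j) ++ fibWord (2 * j + 1))
        (by simp [hq]), List.flatMap_append, flatMap_fibSq_fibWord, flatMap_fibSq_fibWord,
        List.cons_append, List.append_assoc (fibWord (2 * (j + 1))), ← hq']
      rfl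
    rw [← key]
    exact flatMap_lyndonSub_le_rotation hmin

/-- for every `k ≥ 1`, `F*_{2k} = rot^{f_{2k-1} - 1}(F_{2k})`. -/
theorem stmt4 (k : ℕ) (hk : 1 ≤ k) :
    lexMinRotation (fibWord (2 * k)) =
      rot^[(fibWord (2 * k - 1)).length - 1] (fibWord (2 * k)) := by
  obtain ⟨j, rfl⟩ : ∃ j, k = j + 1 := ⟨k - 1, by omega⟩
  obtain ⟨q, hq, hmin⟩ := exists_fibWord_odd_eq_append j
  have hF : fibWord (2 * (j + 1)) = q ++ 0 :: fibWord (2 * j) := by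
    change fibWord (2 * j + 1) ++ fibWord (2 * j) = _
    simp [hq]
  have hlen : (fibWord (2 * (j + 1) - 1)).length - 1 = q.length := by
    change (fibWord (2 * j + 1)).length - 1 = _
    simp [hq]
  rw [hlen]
  apply lexMinRotation_eq_of_isLeast
  · exact List.mem_map_of_mem (by simp [hF])
  · intro v hv
    obtain ⟨i, -, rfl⟩ := List.mem_map.1 hv
    have hrot : (fibWord (2 * (j + 1))).rotate q.length = 0 :: (fibWord (2 * j) ++ q) := by
      rw [hF, List.rotate_append_length_eq, List.cons_append]
    simp only [rot_iterate_eq_rotate]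
    rw [hrot]
    have hr : 0 :: (fibWord (2 * j) ++ q) ~r (fibWord (2 * (j + 1))).rotate i := by
      rw [← hrot]
      exact (List.IsRotated.symm ⟨_, rfl⟩).trans ⟨i, rfl⟩
    obtain ⟨m, hm, hmr⟩ := List.isRotated_iff_mod.1 hr
    rw [← hmr, List.rotate_eq_drop_append_take hm]
    exact hmin _ _ (List.take_append_drop _ _).symm
end

section
/- For every string w over the alphabet {a, b}, θ(w) = rot²(φ²(w)), where rot² denotes the left cyclic rotation by two symbols. -/
/-! Basic definitions: strings as `List α`, rotations, runs, BWT, Lyndon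
factorization, ω-order, bijective BWT, and Fibonacci words. -/

variable {α : Type*}

/-- The morphism `φ(a) = ab`, `φ(b) = a` (with `a = 0`, `b = 1`). -/
def phi (w : List (Fin 2)) : List (Fin 2) :=
  (w.map (fun c => if c = 0 then [0, 1] else [0])).flatten

/-- The morphism `θ(a) = aab`, `θ(b) = ab` (with `a = 0`, `b = 1`). -/
def theta (w : List (Fin 2)) : List (Fin 2) :=
  (w.map (fun c => if c = 0 then [0, 0, 1] else [0, 1])).flatten

/-- `θ` and `φ²` are conjugate morphisms, with conjugating word `ab`. -/
theorem append_theta_eq_phi_phi_append (w : List (Fin 2)) :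
    [0, 1] ++ theta w = phi (phi w) ++ [0, 1] := by
  induction w with
  | nil => rfl
  | cons c t ih =>
    simp only [phi, theta] at ih ⊢
    fin_cases c <;> simp_all

/-- Rotating twice moves a prefix of length two to the end. -/
theorem rot_iterate_two_cons_cons (x y : α) (t : List α) :
    rot^[2] (x :: y :: t) = t ++ [x, y] := by
  simp [rot]

/-- for every string `w` over `{a, b}`, `θ(w) = rot²(φ²(w))`. -/
theorem stmt5 (w : List (Fin 2)) : theta w = rot^[2] (phi (phi w)) := by
  have h := append_theta_eq_phi_phi_append w
  cases w with
  | nil => rfl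
  | cons c t =>
    obtain ⟨u, hu⟩ : ∃ u, phi (phi (c :: t)) = 0 :: 1 :: u := by
      fin_cases c <;> simp [phi]
    rw [hu] at h ⊢
    rw [rot_iterate_two_cons_cons]
    simpa using h
end
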